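/- (Theorem 1) The set CVENN = {σ : σ is a state on ℂ^d ⊗ ℂ^d and S_{A|B}(σ) ≥ 0} is a convex and compact subset of the space of d²×d² complex matrices. -/

import Mathlib

open scoped Kronecker ComplexOrder
open Matrix

noncomputable section

/-- Base-2 matrix logarithm via the functional calculus: same eigenvectors, eigenvalues
replaced by their base-2 logarithms (junk value `0` on non-Hermitian matrices). -/
def matLog2 {n : Type*} [Fintype n] [DecidableEq n] (M : Matrix n n ℂ) : Matrix n n ℂ :=
  if h : M.IsHermitian then
    (h.eigenvectorUnitary : Matrix n n ℂ) *
      Matrix.diagonal (fun i => (Real.logb 2 (h.eigenvalues i) : ℂ)) *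
      (star (h.eigenvectorUnitary : Matrix n n ℂ))
  else 0

/-- von Neumann entropy `S(M) = −∑ λᵢ log₂ λᵢ` over the eigenvalues of `M`
(the convention `0 · log₂ 0 = 0` holds since `Real.logb 2 0 = 0`). -/
def vnEntropy {n : Type*} [Fintype n] [DecidableEq n] (M : Matrix n n ℂ) : ℝ :=
  if h : M.IsHermitian then -∑ i, h.eigenvalues i * Real.logb 2 (h.eigenvalues i) else 0

/-- Partial trace over the first subsystem: `(ρ_B)_{k,l} = ∑ i, ρ_{(i,k),(i,l)}`. -/
def ptraceB {d : ℕ} (ρ : Matrix (Fin d × Fin d) (Fin d × Fin d) ℂ) : Matrix (Fin d) (Fin d) ℂ :=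
  Matrix.of fun k l => ∑ i, ρ (i, k) (i, l)

/-- Partial trace over the second subsystem: `(ρ_A)_{i,j} = ∑ k, ρ_{(i,k),(j,k)}`. -/
def ptraceA {d : ℕ} (ρ : Matrix (Fin d × Fin d) (Fin d × Fin d) ℂ) : Matrix (Fin d) (Fin d) ℂ :=
  Matrix.of fun i j => ∑ k, ρ (i, k) (j, k)

/-- Conditional von Neumann entropy `S_{A|B}(ρ) = S(ρ) − S(ρ_B)`. -/
def condEntropy {d : ℕ} (ρ : Matrix (Fin d × Fin d) (Fin d × Fin d) ℂ) : ℝ :=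
  vnEntropy ρ - vnEntropy (ptraceB ρ)

/-- A state on `ℂ^d ⊗ ℂ^d`: a positive semidefinite matrix with trace 1. -/
def IsState {d : ℕ} (ρ : Matrix (Fin d × Fin d) (Fin d × Fin d) ℂ) : Prop :=
  ρ.PosSemidef ∧ ρ.trace = 1

section Pencil

variable {n : Type*} [Fintype n] [DecidableEq n]

/-- A functional, real-linear in the pair `(ρ, σ)`, whose supremum over `Y` is the quadratic form
of the Hilbert–Schmidt operator `(s L_ρ + (1 - s) R_σ)⁻¹` at `ρ - σ`. -/
def pencil (s : ℝ) (ρ σ Y : Matrix n n ℂ) : ℝ :=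
  2 * (Yᴴ * ρ).trace.re - 2 * (Yᴴ * σ).trace.re
    - s * (Yᴴ * ρ * Y).trace.re - (1 - s) * (Yᴴ * Y * σ).trace.re

/-- The maximum of `pencil` for matrices with spectra `p`, `q` and squared eigenbasis overlaps
`c`. -/
def pencilMax (p q : n → ℝ) (c : n → n → ℝ) (s : ℝ) : ℝ :=
  ∑ i, ∑ j, c i j * ((p i - q j) ^ 2 / (s * p i + (1 - s) * q j))

lemma pencil_add_smul (s a b : ℝ) (ρ σ ρ' σ' Y : Matrix n n ℂ) :
    pencil s (a • ρ + b • ρ') (a • σ + b • σ') Y = a * pencil s ρ σ Y + b * pencil s ρ' σ' Y := by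
  simp only [pencil, mul_add, add_mul, mul_smul_comm, smul_mul_assoc, trace_add, trace_smul,
    Complex.add_re, Complex.smul_re, smul_eq_mul]
  ring

lemma trace_conjTranspose_mul_diagonal_mul (W T : Matrix n n ℂ) (p : n → ℝ) :
    (Wᴴ * diagonal (fun i => (p i : ℂ)) * T).trace.re
      = ∑ i, ∑ j, p i * (star (W i j) * T i j).re := by
  simp only [trace, diag_apply, mul_apply (N := T), mul_diagonal, conjTranspose_apply,
    Complex.re_sum]
  rw [Finset.sum_comm]
  refine Finset.sum_congr rfl fun i _ => Finset.sum_congr rfl fun j _ => ?_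
  simp only [Complex.mul_re, Complex.mul_im, Complex.ofReal_re, Complex.ofReal_im]
  ring

lemma trace_conjTranspose_mul_mul_diagonal (W T : Matrix n n ℂ) (q : n → ℝ) :
    (Wᴴ * T * diagonal (fun i => (q i : ℂ))).trace.re
      = ∑ i, ∑ j, q j * (star (W i j) * T i j).re := by
  simp only [trace, diag_apply, mul_diagonal]
  simp only [mul_apply, conjTranspose_apply, Finset.sum_mul, Complex.re_sum]
  rw [Finset.sum_comm]
  refine Finset.sum_congr rfl fun i _ => Finset.sum_congr rfl fun j _ => ?_
  simp only [Complex.mul_re, Complex.mul_im, Complex.ofReal_re, Complex.ofReal_im]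
  ring

lemma pencil_diagonalized {U V : Matrix n n ℂ} (hU : Uᴴ * U = 1) (hV : Vᴴ * V = 1)
    (p q : n → ℝ) (s : ℝ) (W : Matrix n n ℂ) :
    pencil s (U * diagonal (fun i => (p i : ℂ)) * Uᴴ) (V * diagonal (fun i => (q i : ℂ)) * Vᴴ)
        (U * W * Vᴴ)
      = ∑ i, ∑ j, (2 * (p i - q j) * (star (W i j) * (Uᴴ * V) i j).re
          - (s * p i + (1 - s) * q j) * Complex.normSq (W i j)) := by
  have hUX (X : Matrix n n ℂ) : Uᴴ * (U * X) = X := by rw [← Matrix.mul_assoc, hU, Matrix.one_mul]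
  have hVX (X : Matrix n n ℂ) : Vᴴ * (V * X) = X := by rw [← Matrix.mul_assoc, hV, Matrix.one_mul]
  set P := diagonal (fun i => (p i : ℂ))
  set Q := diagonal (fun i => (q i : ℂ))
  have h1 : ((U * W * Vᴴ)ᴴ * (U * P * Uᴴ)).trace = (Wᴴ * P * (Uᴴ * V)).trace := by
    have : (U * W * Vᴴ)ᴴ * (U * P * Uᴴ) = V * (Wᴴ * P * Uᴴ) := by
      simp only [conjTranspose_mul, conjTranspose_conjTranspose, Matrix.mul_assoc, hUX]
    rw [this, trace_mul_comm]; simp only [Matrix.mul_assoc]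
  have h2 : ((U * W * Vᴴ)ᴴ * (V * Q * Vᴴ)).trace = (Wᴴ * (Uᴴ * V) * Q).trace := by
    have : (U * W * Vᴴ)ᴴ * (V * Q * Vᴴ) = V * (Wᴴ * (Uᴴ * V) * Q * Vᴴ) := by
      simp only [conjTranspose_mul, conjTranspose_conjTranspose, Matrix.mul_assoc]
    rw [this, trace_mul_comm]; simp only [Matrix.mul_assoc, hV, Matrix.mul_one]
  have h3 : ((U * W * Vᴴ)ᴴ * (U * P * Uᴴ) * (U * W * Vᴴ)).trace = (Wᴴ * P * W).trace := by
    have : (U * W * Vᴴ)ᴴ * (U * P * Uᴴ) * (U * W * Vᴴ) = V * (Wᴴ * P * W * Vᴴ) := by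
      simp only [conjTranspose_mul, conjTranspose_conjTranspose, Matrix.mul_assoc, hUX]
    rw [this, trace_mul_comm]; simp only [Matrix.mul_assoc, hV, Matrix.mul_one]
  have h4 : ((U * W * Vᴴ)ᴴ * (U * W * Vᴴ) * (V * Q * Vᴴ)).trace = (Wᴴ * W * Q).trace := by
    have : (U * W * Vᴴ)ᴴ * (U * W * Vᴴ) * (V * Q * Vᴴ) = V * (Wᴴ * W * Q * Vᴴ) := by
      simp only [conjTranspose_mul, conjTranspose_conjTranspose, Matrix.mul_assoc, hUX, hVX]
    rw [this, trace_mul_comm]; simp only [Matrix.mul_assoc, hV, Matrix.mul_one]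
  have h5 (z : ℂ) : (star z * z).re = Complex.normSq z := by
    simp [Complex.normSq_apply]
  rw [pencil, h1, h2, h3, h4]
  simp only [P, Q, trace_conjTranspose_mul_diagonal_mul, trace_conjTranspose_mul_mul_diagonal, h5,
    Finset.mul_sum, ← Finset.sum_sub_distrib]
  refine Finset.sum_congr rfl fun i _ => Finset.sum_congr rfl fun j _ => ?_
  ring

lemma two_mul_re_sub_le_div {m : ℝ} (hm : 0 < m) (r : ℝ) (w t : ℂ) :
    2 * r * (star w * t).re - m * Complex.normSq w ≤ Complex.normSq t * (r ^ 2 / m) := by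
  rw [← mul_div_assoc, le_div_iff₀ hm]
  simp only [Complex.normSq_apply, Complex.mul_re, Complex.star_def, Complex.conj_re,
    Complex.conj_im]
  nlinarith [sq_nonneg (m * w.re - r * t.re), sq_nonneg (m * w.im - r * t.im)]

lemma two_mul_re_sub_eq_div {m : ℝ} (hm : 0 < m) (r : ℝ) (t : ℂ) :
    2 * r * (star (((r / m : ℝ) : ℂ) * t) * t).re - m * Complex.normSq (((r / m : ℝ) : ℂ) * t)
      = Complex.normSq t * (r ^ 2 / m) := by
  simp only [Complex.normSq_apply, Complex.mul_re, Complex.mul_im, Complex.star_def,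
    Complex.conj_re, Complex.conj_im, Complex.ofReal_re, Complex.ofReal_im]
  field_simp
  ring

lemma isGreatest_pencil {U V : Matrix n n ℂ} (hU : Uᴴ * U = 1) (hV : Vᴴ * V = 1)
    {p q : n → ℝ} (hp : ∀ i, 0 < p i) (hq : ∀ i, 0 < q i) {s : ℝ} (hs : s ∈ Set.Icc (0 : ℝ) 1) :
    IsGreatest (Set.range (pencil s (U * diagonal (fun i => (p i : ℂ)) * Uᴴ)
        (V * diagonal (fun i => (q i : ℂ)) * Vᴴ)))
      (pencilMax p q (fun i j => Complex.normSq ((Uᴴ * V) i j)) s) := by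
  have hm (i j) : 0 < s * p i + (1 - s) * q j := by
    simpa [smul_eq_mul] using
      (convex_Ioi (0 : ℝ)) (hp i) (hq j) hs.1 (sub_nonneg.2 hs.2) (by ring)
  refine ⟨⟨U * (of fun i j => (((p i - q j) / (s * p i + (1 - s) * q j) : ℝ) : ℂ) * (Uᴴ * V) i j)
    * Vᴴ, ?_⟩, ?_⟩
  · rw [pencil_diagonalized hU hV, pencilMax]
    refine Finset.sum_congr rfl fun i _ => Finset.sum_congr rfl fun j _ => ?_
    exact two_mul_re_sub_eq_div (hm i j) _ _
  · rintro _ ⟨Y, rfl⟩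
    have hY : Y = U * (Uᴴ * Y * V) * Vᴴ := by
      simp only [Matrix.mul_assoc, mul_eq_one_comm.1 hV, Matrix.mul_one]
      rw [← Matrix.mul_assoc, mul_eq_one_comm.1 hU, Matrix.one_mul]
    rw [hY, pencil_diagonalized hU hV, pencilMax]
    refine Finset.sum_le_sum fun i _ => Finset.sum_le_sum fun j _ => ?_
    exact two_mul_re_sub_le_div (hm i j) _ _ _

end Pencil

section LogIntegral

lemma continuousOn_log_kernel {p q : ℝ} (hp : 0 < p) (hq : 0 < q) :
    ContinuousOn (fun s : ℝ => (1 - s) * ((p - q) ^ 2 / (s * p + (1 - s) * q)))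
      (Set.uIcc 0 1) := by
  have hm : ∀ s ∈ Set.uIcc (0 : ℝ) 1, s * p + (1 - s) * q ≠ 0 := by
    intro s hs
    rw [Set.uIcc_of_le zero_le_one] at hs
    have : 0 < s * p + (1 - s) * q := by
      simpa [smul_eq_mul] using (convex_Ioi (0 : ℝ)) hp hq hs.1 (sub_nonneg.2 hs.2) (by ring)
    exact this.ne'
  fun_prop (disch := assumption)

lemma integral_log_kernel {p q : ℝ} (hp : 0 < p) (hq : 0 < q) :
    ∫ s in (0 : ℝ)..1, (1 - s) * ((p - q) ^ 2 / (s * p + (1 - s) * q))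
      = p * (Real.log p - Real.log q) - (p - q) := by
  have hd : ∀ s ∈ Set.uIcc (0 : ℝ) 1,
      HasDerivAt (fun s => (p - q) * (-s) + p * Real.log (s * p + (1 - s) * q))
        ((1 - s) * ((p - q) ^ 2 / (s * p + (1 - s) * q))) s := by
    intro s hs
    rw [Set.uIcc_of_le zero_le_one] at hs
    have hm : 0 < s * p + (1 - s) * q := by
      simpa [smul_eq_mul] using (convex_Ioi (0 : ℝ)) hp hq hs.1 (sub_nonneg.2 hs.2) (by ring)
    have h1 : HasDerivAt (fun s : ℝ => s * p + (1 - s) * q) (1 * p + (-1) * q) s :=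
      ((hasDerivAt_id s).mul_const p).add (((hasDerivAt_id s).const_sub 1).mul_const q)
    have h2 := ((hasDerivAt_id s).neg.const_mul (p - q)).add ((h1.log hm.ne').const_mul p)
    refine h2.congr_deriv ?_
    rw [← mul_div_assoc, ← mul_div_assoc, eq_div_iff hm.ne', add_mul, div_mul_cancel₀ _ hm.ne']
    ring
  rw [intervalIntegral.integral_eq_sub_of_hasDerivAt hd
    (continuousOn_log_kernel hp hq).intervalIntegrable]
  simp only [one_mul, zero_mul, sub_self, sub_zero, add_zero, zero_add]
  ring

lemma intervalIntegrable_pencilMax {n : Type*} [Fintype n] {p q : n → ℝ} (c : n → n → ℝ)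
    (hp : ∀ i, 0 < p i) (hq : ∀ i, 0 < q i) :
    IntervalIntegrable (fun s => (1 - s) * pencilMax p q c s) MeasureTheory.volume 0 1 := by
  apply ContinuousOn.intervalIntegrable
  simp only [pencilMax, Finset.mul_sum, mul_left_comm (1 - _ : ℝ)]
  exact continuousOn_finsetSum _ fun i _ => continuousOn_finsetSum _ fun j _ =>
    continuousOn_const.mul (continuousOn_log_kernel (hp i) (hq j))

lemma integral_pencilMax {n : Type*} [Fintype n] {p q : n → ℝ} (c : n → n → ℝ)
    (hp : ∀ i, 0 < p i) (hq : ∀ i, 0 < q i) :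
    ∫ s in (0 : ℝ)..1, (1 - s) * pencilMax p q c s
      = ∑ i, ∑ j, c i j * (p i * (Real.log (p i) - Real.log (q j)) - (p i - q j)) := by
  have hi (i j) : ContinuousOn
      (fun s => c i j * ((1 - s) * ((p i - q j) ^ 2 / (s * p i + (1 - s) * q j))))
      (Set.uIcc 0 1) :=
    continuousOn_const.mul (continuousOn_log_kernel (hp i) (hq j))
  simp only [pencilMax, Finset.mul_sum, mul_left_comm (1 - _ : ℝ)]
  rw [intervalIntegral.integral_finsetSum fun i _ =>
    (continuousOn_finsetSum _ fun j _ => hi i j).intervalIntegrable]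
  refine Finset.sum_congr rfl fun i _ => ?_
  rw [intervalIntegral.integral_finsetSum fun j _ => (hi i j).intervalIntegrable]
  refine Finset.sum_congr rfl fun j _ => ?_
  rw [intervalIntegral.integral_const_mul, integral_log_kernel (hp i) (hq j)]

end LogIntegral

section CondEntropy

lemma eq_eigenvectorUnitary_mul_diagonal {n : Type*} [Fintype n] [DecidableEq n]
    {M : Matrix n n ℂ} (h : M.IsHermitian) :
    M = (h.eigenvectorUnitary : Matrix n n ℂ) * diagonal (fun i => (h.eigenvalues i : ℂ))
      * (h.eigenvectorUnitary : Matrix n n ℂ)ᴴ := by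
  conv_lhs => rw [h.spectral_theorem, Unitary.conjStarAlgAut_apply]
  rfl

lemma vnEntropy_mul_log_two {n : Type*} [Fintype n] [DecidableEq n] {M : Matrix n n ℂ}
    (h : M.IsHermitian) :
    vnEntropy M * Real.log 2 = -∑ i, h.eigenvalues i * Real.log (h.eigenvalues i) := by
  have h2 : Real.log 2 ≠ 0 := (Real.log_pos one_lt_two).ne'
  simp only [vnEntropy, dif_pos h, Real.logb, neg_mul, Finset.sum_mul, mul_assoc,
    div_mul_cancel₀ _ h2]

lemma continuousOn_vnEntropy {n : Type*} [Fintype n] [DecidableEq n] :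
    ContinuousOn (vnEntropy : Matrix n n ℂ → ℝ) {M | M.IsHermitian} := by
  have hcfc : ContinuousOn (fun M : Matrix n n ℂ => cfc Real.negMulLog M) {M | M.IsHermitian} := by
    open scoped Matrix.Norms.L2Operator in
    exact continuousOn_id.cfc_of_mem_nhdsSet (s := Set.univ) Real.negMulLog Filter.univ_mem
      (fun M hM => hM) Real.continuous_negMulLog.continuousOn
  have hre : ContinuousOn (fun M : Matrix n n ℂ => (cfc Real.negMulLog M).trace.re / Real.log 2)
      {M | M.IsHermitian} :=
    (Complex.continuous_re.comp_continuousOn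
      ((continuous_id.matrix_trace).comp_continuousOn hcfc)).div_const _
  refine hre.congr fun M hM => ?_
  have hM : M.IsHermitian := hM
  rw [eq_div_iff (Real.log_pos one_lt_two).ne', vnEntropy_mul_log_two hM, hM.cfc_eq,
    IsHermitian.cfc, Unitary.conjStarAlgAut_apply, trace_mul_comm, ← Matrix.mul_assoc,
    Unitary.coe_star_mul_self, Matrix.one_mul, trace_diagonal]
  simp [Real.negMulLog]

variable {d : ℕ}

lemma ptraceB_eq_sum_submatrix (ρ : Matrix (Fin d × Fin d) (Fin d × Fin d) ℂ) :
    ptraceB ρ = ∑ i, ρ.submatrix (Prod.mk i) (Prod.mk i) := by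
  ext k l
  simp [ptraceB, Matrix.sum_apply]

lemma ptraceB_add_smul (a b : ℝ) (ρ τ : Matrix (Fin d × Fin d) (Fin d × Fin d) ℂ) :
    ptraceB (a • ρ + b • τ) = a • ptraceB ρ + b • ptraceB τ := by
  ext k l
  simp [ptraceB, Finset.sum_add_distrib, Finset.mul_sum]

lemma continuous_ptraceB :
    Continuous (ptraceB : Matrix (Fin d × Fin d) (Fin d × Fin d) ℂ → Matrix (Fin d) (Fin d) ℂ) := by
  refine continuous_matrix fun k l => ?_
  simp only [ptraceB, of_apply]
  fun_prop

lemma isHermitian_ptraceB {ρ : Matrix (Fin d × Fin d) (Fin d × Fin d) ℂ} (h : ρ.IsHermitian) :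
    (ptraceB ρ).IsHermitian := by
  ext k l
  simp only [conjTranspose_apply, ptraceB, of_apply, star_sum]
  exact Finset.sum_congr rfl fun i _ => h.apply _ _

lemma posDef_ptraceB (hd : 0 < d) {ρ : Matrix (Fin d × Fin d) (Fin d × Fin d) ℂ}
    (h : ρ.PosDef) : (ptraceB ρ).PosDef := by
  rw [ptraceB_eq_sum_submatrix]
  exact posDef_sum ⟨⟨0, hd⟩, Finset.mem_univ _⟩ fun i _ => h.submatrix (Prod.mk_right_injective i)

lemma continuousOn_condEntropy :
    ContinuousOn (condEntropy : Matrix (Fin d × Fin d) (Fin d × Fin d) ℂ → ℝ)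
      {M | M.IsHermitian} :=
  continuousOn_vnEntropy.sub
    (continuousOn_vnEntropy.comp continuous_ptraceB.continuousOn fun _ h => isHermitian_ptraceB h)

lemma conjTranspose_ptraceB_mul (V : Matrix (Fin d) (Fin d) ℂ)
    (ρ : Matrix (Fin d × Fin d) (Fin d × Fin d) ℂ) :
    ptraceB (((1 : Matrix (Fin d) (Fin d) ℂ) ⊗ₖ V)ᴴ * ρ * ((1 : Matrix (Fin d) (Fin d) ℂ) ⊗ₖ V))
      = Vᴴ * ptraceB ρ * V := by
  ext k l
  simp only [ptraceB, of_apply, mul_apply, conjTranspose_apply, kroneckerMap_apply,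
    Fintype.sum_prod_type, one_apply, Finset.sum_mul, Finset.mul_sum]
  simp only [ite_mul, one_mul, zero_mul, mul_ite, mul_zero, apply_ite star, star_zero]
  simp only [RCLike.star_def, Finset.sum_ite_irrel, Finset.sum_const_zero, Finset.sum_ite_eq',
    Finset.mem_univ, if_true]
  rw [Finset.sum_comm]
  refine Finset.sum_congr rfl fun _ _ => ?_
  rw [Finset.sum_comm]

lemma sum_normSq_row {n : Type*} [Fintype n] [DecidableEq n] {T : Matrix n n ℂ}
    (hT : T * Tᴴ = 1) (i : n) : ∑ j, Complex.normSq (T i j) = 1 := by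
  have h := congrArg Complex.re (congrFun (congrFun hT i) i)
  simpa [mul_apply, Complex.normSq_apply] using h

lemma sum_normSq_col {n : Type*} [Fintype n] [DecidableEq n] {T : Matrix n n ℂ}
    (hT : Tᴴ * T = 1) (j : n) : ∑ i, Complex.normSq (T i j) = 1 := by
  have h := congrArg Complex.re (congrFun (congrFun hT j) j)
  simpa [mul_apply, Complex.normSq_apply] using h

/-- On positive definite matrices, the conditional entropy is an affine functional minus a
weighted integral of maxima of real-linear functionals. -/
lemma condEntropy_integral_representation (hd : 0 < d)
    {ρ : Matrix (Fin d × Fin d) (Fin d × Fin d) ℂ} (h : ρ.PosDef) :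
    ∃ G : ℝ → ℝ,
      IntervalIntegrable (fun s => (1 - s) * G s) MeasureTheory.volume 0 1 ∧
      condEntropy ρ * Real.log 2
        = (d - 1) * ρ.trace.re - ∫ s in (0 : ℝ)..1, (1 - s) * G s ∧
      ∀ s ∈ Set.Icc (0 : ℝ) 1, IsGreatest
        (Set.range (pencil s ρ ((1 : Matrix (Fin d) (Fin d) ℂ) ⊗ₖ ptraceB ρ))) (G s) := by
  have hB := posDef_ptraceB hd h
  set p := h.1.eigenvalues with hp_def
  set q := hB.1.eigenvalues
  set U : Matrix (Fin d × Fin d) (Fin d × Fin d) ℂ :=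
    (h.1.eigenvectorUnitary : Matrix (Fin d × Fin d) (Fin d × Fin d) ℂ)
  set V : Matrix (Fin d) (Fin d) ℂ :=
    (hB.1.eigenvectorUnitary : Matrix (Fin d) (Fin d) ℂ)
  have hρ : ρ = U * diagonal (fun i => (p i : ℂ)) * Uᴴ := eq_eigenvectorUnitary_mul_diagonal h.1
  have hρB : ptraceB ρ = V * diagonal (fun i => (q i : ℂ)) * Vᴴ :=
    eq_eigenvectorUnitary_mul_diagonal hB.1
  have hU : Uᴴ * U = 1 := Unitary.coe_star_mul_self _
  have hV : Vᴴ * V = 1 := Unitary.coe_star_mul_self _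
  set K : Matrix (Fin d × Fin d) (Fin d × Fin d) ℂ := (1 : Matrix (Fin d) (Fin d) ℂ) ⊗ₖ V
    with hK_def
  have hK : Kᴴ * K = 1 := by
    rw [hK_def, conjTranspose_kronecker, ← mul_kronecker_mul, hV, conjTranspose_one,
      Matrix.one_mul, one_kronecker_one]
  have hσ : (1 : Matrix (Fin d) (Fin d) ℂ) ⊗ₖ ptraceB ρ
      = K * diagonal (fun x : Fin d × Fin d => (q x.2 : ℂ)) * Kᴴ := by
    have hdiag : diagonal (fun x : Fin d × Fin d => (q x.2 : ℂ))
        = (1 : Matrix (Fin d) (Fin d) ℂ) ⊗ₖ diagonal (fun i => (q i : ℂ)) := by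
      rw [← diagonal_one, diagonal_kronecker_diagonal]
      simp
    rw [hdiag, hK_def, conjTranspose_kronecker, ← mul_kronecker_mul, ← mul_kronecker_mul, ← hρB]
    simp
  have hp : ∀ i, 0 < p i := h.eigenvalues_pos
  have hq : ∀ i, 0 < q i := hB.eigenvalues_pos
  set c : Fin d × Fin d → Fin d × Fin d → ℝ := fun i j => Complex.normSq ((Uᴴ * K) i j) with hc
  have hT : (Uᴴ * K)ᴴ * (Uᴴ * K) = 1 := by
    rw [conjTranspose_mul, conjTranspose_conjTranspose, Matrix.mul_assoc, ← Matrix.mul_assoc U,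
      mul_eq_one_comm.1 hU, Matrix.one_mul, hK]
  have hrow : ∀ i, ∑ j, c i j = 1 := sum_normSq_row (mul_eq_one_comm.1 hT)
  have hcol : ∀ j, ∑ i, c i j = 1 := sum_normSq_col hT
  have hmarginal (j : Fin d) : ∑ a, ∑ i, c i (a, j) * p i = q j := by
    have h1 : Kᴴ * ρ * K = (Uᴴ * K)ᴴ * diagonal (fun i => (p i : ℂ)) * (Uᴴ * K) := by
      rw [hρ]
      simp only [conjTranspose_mul, conjTranspose_conjTranspose, Matrix.mul_assoc]
    have h2 : ptraceB (Kᴴ * ρ * K) = diagonal (fun i => (q i : ℂ)) := by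
      rw [hK_def, conjTranspose_ptraceB_mul, hρB]
      simp only [Matrix.mul_assoc, hV, Matrix.mul_one]
      rw [← Matrix.mul_assoc, hV, Matrix.one_mul]
    have h3 := congrArg Complex.re (congrFun (congrFun h2 j) j)
    rw [h1] at h3
    simp only [ptraceB, of_apply, mul_apply (N := Uᴴ * K), mul_diagonal, diagonal_apply_eq,
      conjTranspose_apply, Complex.re_sum, Complex.ofReal_re] at h3
    rw [← h3]
    refine Finset.sum_congr rfl fun a _ => Finset.sum_congr rfl fun i _ => ?_
    simp only [hc, Complex.normSq_apply, Complex.mul_re, Complex.mul_im, Complex.star_def,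
      Complex.conj_re, Complex.conj_im, Complex.ofReal_re, Complex.ofReal_im]
    ring
  have htrace : ρ.trace.re = ∑ i, p i := by
    rw [h.1.trace_eq_sum_eigenvalues]
    simp [hp_def]
  have htraceB : ∑ j, q j = ∑ i, p i := by
    rw [← Finset.sum_congr rfl fun j _ => hmarginal j, ← Fintype.sum_prod_type_right'
      (f := fun a j => ∑ i, c i (a, j) * p i), Finset.sum_comm]
    refine Finset.sum_congr rfl fun i _ => ?_
    rw [← Finset.sum_mul, hrow, one_mul]
  refine ⟨pencilMax p (fun x => q x.2) c, intervalIntegrable_pencilMax c hp fun x => hq x.2, ?_,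
    fun s hs => ?_⟩
  · rw [integral_pencilMax c hp fun x => hq x.2, condEntropy, sub_mul, vnEntropy_mul_log_two h.1,
      vnEntropy_mul_log_two hB.1, htrace]
    have e1 : ∑ i, ∑ j, c i j * (p i * Real.log (p i)) = ∑ i, p i * Real.log (p i) :=
      Finset.sum_congr rfl fun i _ => by rw [← Finset.sum_mul, hrow, one_mul]
    have e2 : ∑ i, ∑ j, c i j * p i = ∑ i, p i :=
      Finset.sum_congr rfl fun i _ => by rw [← Finset.sum_mul, hrow, one_mul]
    have e3 : ∑ i, ∑ j, c i j * q j.2 = d * ∑ i, p i := by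
      rw [Finset.sum_comm, ← htraceB]
      simp only [← Finset.sum_mul, hcol, one_mul, Fintype.sum_prod_type, Finset.sum_const,
        Finset.card_univ, Fintype.card_fin, nsmul_eq_mul]
    have e4 : ∑ i, ∑ j, c i j * (p i * Real.log (q j.2)) = ∑ j, q j * Real.log (q j) := by
      rw [Finset.sum_comm, Fintype.sum_prod_type_right]
      refine Finset.sum_congr rfl fun j _ => ?_
      simp only [← mul_assoc, ← Finset.sum_mul, hmarginal]
    simp only [mul_sub, Finset.sum_sub_distrib, e1, e2, e3, e4]
    ring
  · rw [hσ]
    nth_rw 1 [hρ]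
    exact isGreatest_pencil hU hK hp (fun x => hq x.2) hs

lemma condEntropy_concave_of_posDef (hd : 0 < d)
    {ρ τ : Matrix (Fin d × Fin d) (Fin d × Fin d) ℂ} (hρ : ρ.PosDef) (hτ : τ.PosDef)
    {a b : ℝ} (ha : 0 ≤ a) (hb : 0 ≤ b) (hab : a + b = 1) :
    a * condEntropy ρ + b * condEntropy τ ≤ condEntropy (a • ρ + b • τ) := by
  have hconv : (a • ρ + b • τ).PosDef := by
    rcases ha.eq_or_lt with rfl | ha
    · rw [zero_add] at hab
      simpa [hab] using hτ
    · exact (hρ.smul ha).add_posSemidef (hτ.posSemidef.smul hb)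
  obtain ⟨G₁, hi₁, he₁, hg₁⟩ := condEntropy_integral_representation hd hρ
  obtain ⟨G₂, hi₂, he₂, hg₂⟩ := condEntropy_integral_representation hd hτ
  obtain ⟨G, hi, he, hg⟩ := condEntropy_integral_representation hd hconv
  have hG : ∀ s ∈ Set.Icc (0 : ℝ) 1, G s ≤ a * G₁ s + b * G₂ s := by
    intro s hs
    obtain ⟨Y, hY⟩ := (hg s hs).1
    rw [← hY, ptraceB_add_smul, kronecker_add, kronecker_smul, kronecker_smul, pencil_add_smul]
    exact add_le_add (mul_le_mul_of_nonneg_left ((hg₁ s hs).2 ⟨Y, rfl⟩) ha)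
      (mul_le_mul_of_nonneg_left ((hg₂ s hs).2 ⟨Y, rfl⟩) hb)
  have hint : ∫ s in (0 : ℝ)..1, (1 - s) * G s
      ≤ a * (∫ s in (0 : ℝ)..1, (1 - s) * G₁ s) + b * ∫ s in (0 : ℝ)..1, (1 - s) * G₂ s := by
    rw [← intervalIntegral.integral_const_mul, ← intervalIntegral.integral_const_mul,
      ← intervalIntegral.integral_add (hi₁.const_mul a) (hi₂.const_mul b)]
    refine intervalIntegral.integral_mono_on zero_le_one hi
      ((hi₁.const_mul a).add (hi₂.const_mul b)) fun s hs => ?_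
    have := mul_le_mul_of_nonneg_left (hG s hs) (sub_nonneg.2 hs.2)
    linarith
  have htr : (a • ρ + b • τ).trace.re = a * ρ.trace.re + b * τ.trace.re := by
    simp [trace_add, trace_smul]
  rw [htr] at he
  refine le_of_mul_le_mul_right ?_ (Real.log_pos one_lt_two)
  rw [add_mul, mul_assoc, mul_assoc, he₁, he₂, he]
  linarith

lemma condEntropy_concave (hd : 0 < d)
    {ρ τ : Matrix (Fin d × Fin d) (Fin d × Fin d) ℂ} (hρ : ρ.PosSemidef) (hτ : τ.PosSemidef)
    {a b : ℝ} (ha : 0 ≤ a) (hb : 0 ≤ b) (hab : a + b = 1) :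
    a * condEntropy ρ + b * condEntropy τ ≤ condEntropy (a • ρ + b • τ) := by
  have hpd {M : Matrix (Fin d × Fin d) (Fin d × Fin d) ℂ} (hM : M.PosSemidef) {ε : ℝ}
      (hε : 0 < ε) : (M + ε • 1).PosDef := (PosDef.one.smul hε).posSemidef_add hM
  have hlim {M : Matrix (Fin d × Fin d) (Fin d × Fin d) ℂ} (hM : M.PosSemidef) :
      Filter.Tendsto (fun ε : ℝ => condEntropy (M + ε • 1)) (nhdsWithin 0 (Set.Ioi 0))
        (nhds (condEntropy M)) := by
    refine (continuousOn_condEntropy M hM.1).tendsto.comp (tendsto_nhdsWithin_iff.2 ⟨?_, ?_⟩)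
    · have : Continuous fun ε : ℝ => M + ε • (1 : Matrix (Fin d × Fin d) (Fin d × Fin d) ℂ) := by
        fun_prop
      simpa using (this.tendsto 0).mono_left nhdsWithin_le_nhds
    · filter_upwards [self_mem_nhdsWithin] with ε hε using (hpd hM hε).1
  refine le_of_tendsto_of_tendsto (((hlim hρ).const_mul a).add ((hlim hτ).const_mul b))
    (hlim ((hρ.smul ha).add (hτ.smul hb))) ?_
  filter_upwards [self_mem_nhdsWithin] with ε hε
  have hmix : a • ρ + b • τ + ε • 1 = a • (ρ + ε • 1) + b • (τ + ε • 1) := by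
    rw [smul_add, smul_add, add_add_add_comm, ← add_smul, hab, one_smul]
  rw [hmix]
  exact condEntropy_concave_of_posDef hd (hpd hρ hε) (hpd hτ hε) ha hb hab

end CondEntropy

section States

lemma norm_entry_le_trace {n : Type*} [Fintype n] [DecidableEq n] {M : Matrix n n ℂ}
    (h : M.PosSemidef) (i j : n) : ‖M i j‖ ≤ M.trace.re := by
  have htrace : M.trace.re = ∑ k, h.1.eigenvalues k := by
    rw [h.1.trace_eq_sum_eigenvalues]
    simp
  have hU := entry_norm_bound_of_unitary h.1.eigenvectorUnitary.2
  rw [htrace]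
  conv_lhs => rw [eq_eigenvectorUnitary_mul_diagonal h.1]
  simp only [mul_apply (N := (_)ᴴ), mul_diagonal, conjTranspose_apply]
  refine (norm_sum_le _ _).trans (Finset.sum_le_sum fun k _ => ?_)
  rw [norm_mul, norm_mul, norm_star, Complex.norm_real,
    Real.norm_of_nonneg (h.eigenvalues_nonneg k)]
  calc _ ≤ 1 * h.1.eigenvalues k * 1 := by
        gcongr
        · exact mul_nonneg zero_le_one (h.eigenvalues_nonneg k)
        · exact h.eigenvalues_nonneg k
        · exact hU i k
        · exact hU j k
    _ = h.1.eigenvalues k := by ring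

lemma isClosed_setOf_posSemidef {n : Type*} [Fintype n] :
    IsClosed {M : Matrix n n ℂ | M.PosSemidef} := by
  simp only [posSemidef_iff_dotProduct_mulVec, Set.ofPred_and, Set.ofPred_forall]
  refine IsClosed.inter (isClosed_eq continuous_id.matrix_conjTranspose continuous_id)
    (isClosed_iInter fun x => isClosed_le continuous_const ?_)
  exact continuous_const.dotProduct (continuous_id.matrix_mulVec continuous_const)

variable {d : ℕ}

lemma isCompact_setOf_isState :
    IsCompact {σ : Matrix (Fin d × Fin d) (Fin d × Fin d) ℂ | IsState σ} := by
  have hbox : IsCompact (Set.univ.pi fun _ => Set.univ.pi fun _ => Metric.closedBall 0 1 :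
      Set (Matrix (Fin d × Fin d) (Fin d × Fin d) ℂ)) :=
    isCompact_univ_pi fun _ => isCompact_univ_pi fun _ => isCompact_closedBall 0 1
  refine hbox.of_isClosed_subset
    (isClosed_setOf_posSemidef.inter (isClosed_eq continuous_id.matrix_trace continuous_const)) ?_
  rintro σ ⟨hpos, htr⟩ i - j -
  simpa [htr] using norm_entry_le_trace hpos i j

end States

/-- Theorem 1: CVENN is convex and compact. -/
theorem cvenn_convex_compact {d : ℕ} (hd : 0 < d) :
    Convex ℝ {σ : Matrix (Fin d × Fin d) (Fin d × Fin d) ℂ | IsState σ ∧ 0 ≤ condEntropy σ} ∧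
    IsCompact {σ : Matrix (Fin d × Fin d) (Fin d × Fin d) ℂ | IsState σ ∧ 0 ≤ condEntropy σ} := by
  refine ⟨?_, ?_⟩
  · rintro ρ ⟨⟨hρ, hρ₁⟩, hρ₀⟩ τ ⟨⟨hτ, hτ₁⟩, hτ₀⟩ a b ha hb hab
    refine ⟨⟨(hρ.smul ha).add (hτ.smul hb), ?_⟩, ?_⟩
    · rw [trace_add, trace_smul, trace_smul, hρ₁, hτ₁, ← add_smul, hab, one_smul]
    · exact (add_nonneg (mul_nonneg ha hρ₀) (mul_nonneg hb hτ₀)).trans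
        (condEntropy_concave hd hρ hτ ha hb hab)
  · refine isCompact_setOf_isState.of_isClosed_subset ?_ fun σ hσ => hσ.1
    exact (continuousOn_condEntropy.mono fun σ hσ => hσ.1.1).preimage_isClosed_of_isClosed
      isCompact_setOf_isState.isClosed isClosed_Ici
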